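/- Let h : 2^N → ℝ_{≥0} be a non-negative submodular function on a finite ground set N, and let B be a random subset of N such that every element of N belongs to B with probability at most p (not necessarily independently). Then E[h(B)] ≥ (1 − p)·h(∅). -/

import Mathlib

open MeasureTheory

/-- Adding an element of `A` to the window `S` changes `h (A ∩ S)` by at least the marginal of that
element with respect to the whole of `S`, by diminishing returns. -/
theorem submodular_inter_insert_ge {N : Type*} [DecidableEq N] {h : Finset N → ℝ}
    (h_submod : ∀ X Y : Finset N, h (X ∪ Y) + h (X ∩ Y) ≤ h X + h Y)
    {a : N} {S : Finset N} (ha : a ∉ S) (A : Finset N) :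
    h (A ∩ S) + (if a ∈ A then h (insert a S) - h S else 0) ≤ h (A ∩ insert a S) := by
  split_ifs with haA
  · have hsub := h_submod (A ∩ insert a S) S
    have hunion : A ∩ insert a S ∪ S = insert a S := by grind
    have hinter : A ∩ insert a S ∩ S = A ∩ S := by grind
    rw [hunion, hinter] at hsub
    linarith
  · rw [Finset.inter_insert_of_notMem haA, add_zero]

/-- A real function of a random finite subset of a finite type is integrable. -/
theorem integrable_comp_random_finset {N : Type*} [Fintype N]
    {Ω : Type*} [MeasurableSpace Ω] {μ : Measure Ω} [IsFiniteMeasure μ]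
    {B : Ω → Finset N} (hB_meas : ∀ s : Finset N, MeasurableSet {ω | B ω = s})
    (g : Finset N → ℝ) : Integrable (fun ω => g (B ω)) μ := by
  let _ : MeasurableSpace (Finset N) := ⊤
  have hB : Measurable B := measurable_to_countable' hB_meas
  exact (Integrable.of_finite (μ := μ.map B) (f := g)).comp_measurable hB

/-- The expectation of `h (B ∩ S)` is at least `(1 - p) * h ∅ + q * h S` whenever `q` is a lower
bound and `p` an upper bound for the membership probabilities of the elements of `S`. -/
theorem integral_inter_ge {N : Type*} [Fintype N] [DecidableEq N]
    {Ω : Type*} [MeasurableSpace Ω] (μ : Measure Ω) [IsProbabilityMeasure μ]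
    {h : Finset N → ℝ} (h_nonneg : ∀ X : Finset N, 0 ≤ h X)
    (h_submod : ∀ X Y : Finset N, h (X ∪ Y) + h (X ∩ Y) ≤ h X + h Y)
    {B : Ω → Finset N} (hB_meas : ∀ s : Finset N, MeasurableSet {ω | B ω = s})
    {p : ℝ} (hprob : ∀ x : N, μ.real {ω | x ∈ B ω} ≤ p) (S : Finset N) :
    ∀ q ≤ p, (∀ x ∈ S, q ≤ μ.real {ω | x ∈ B ω}) →
      (1 - p) * h ∅ + q * h S ≤ ∫ ω, h (B ω ∩ S) ∂μ := by
  induction S using Finset.induction_on_min_value (fun x => μ.real {ω | x ∈ B ω}) with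
  | empty =>
    intro q hq _
    simp only [Finset.inter_empty, integral_const, probReal_univ, one_smul]
    nlinarith [h_nonneg ∅]
  | insert a S ha hmin ih =>
    intro q _ hqS
    have hqa : q ≤ μ.real {ω | a ∈ B ω} := hqS a (Finset.mem_insert_self a S)
    have hmeas : MeasurableSet {ω | a ∈ B ω} := by
      have hcover : {ω | a ∈ B ω} = ⋃ s ∈ {s : Finset N | a ∈ s}, {ω | B ω = s} := by
        ext ω
        simp
      rw [hcover]
      exact MeasurableSet.biUnion (Set.to_countable _) fun s _ => hB_meas s
    have hmarginal : ∫ ω, (if a ∈ B ω then h (insert a S) - h S else 0) ∂μ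
        = μ.real {ω | a ∈ B ω} * (h (insert a S) - h S) := by
      rw [← smul_eq_mul, ← integral_indicator_const _ hmeas]
      simp only [Set.indicator_apply, Set.mem_ofPred_eq]
    have hstep : ∫ ω, h (B ω ∩ S) ∂μ + μ.real {ω | a ∈ B ω} * (h (insert a S) - h S)
        ≤ ∫ ω, h (B ω ∩ insert a S) ∂μ := by
      have hint (g : Finset N → ℝ) : Integrable (fun ω => g (B ω)) μ :=
        integrable_comp_random_finset hB_meas g
      have hint_inter := hint fun A => h (A ∩ S)
      have hint_marginal := hint fun A => if a ∈ A then h (insert a S) - h S else 0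
      rw [← hmarginal, ← integral_add hint_inter hint_marginal]
      exact integral_mono (hint_inter.add hint_marginal) (hint fun A => h (A ∩ insert a S))
        fun ω => submodular_inter_insert_ge h_submod ha (B ω)
    have hS := ih _ (hprob a) hmin
    have hq := mul_le_mul_of_nonneg_right hqa (h_nonneg (insert a S))
    linarith

/-- Lemma 2.2 of Buchbinder–Feldman–Naor–Schwartz. Let
`h : 2^N → ℝ≥0` be a non-negative submodular function on a finite ground set `N`, and
let `B` be a random subset of `N` (on some probability space, not necessarily with
independent coordinates) containing every element of `N` with probability at most `p`.
Then `E[h(B)] ≥ (1 − p)·h(∅)`. -/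
theorem expected_value_ge_one_sub_p_mul_empty
    {N : Type*} [Fintype N] [DecidableEq N]
    {Ω : Type*} [MeasurableSpace Ω] (μ : Measure Ω) [IsProbabilityMeasure μ]
    (h : Finset N → ℝ)
    (h_nonneg : ∀ X : Finset N, 0 ≤ h X)
    (h_submod : ∀ X Y : Finset N, h (X ∪ Y) + h (X ∩ Y) ≤ h X + h Y)
    (B : Ω → Finset N)
    (hB_meas : ∀ s : Finset N, MeasurableSet {ω | B ω = s})
    (p : ℝ) (hp0 : 0 ≤ p) (hp1 : p ≤ 1)
    (hprob : ∀ x : N, (μ {ω | x ∈ B ω}).toReal ≤ p) :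
    (1 - p) * h ∅ ≤ ∫ ω, h (B ω) ∂μ := by
  have hmain := integral_inter_ge μ h_nonneg h_submod hB_meas hprob Finset.univ 0 hp0
    fun _ _ => measureReal_nonneg
  simpa using hmain
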